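/- Let I be a proper *-ideal of ℂ[X₁,…,Xₙ]. Then the real zero set Z(I) is empty if and only if every positive definite linear functional Λ on ℂ[X₁,…,Xₙ] that vanishes on I is the zero functional. -/

import Mathlib

open MeasureTheory
open scoped ComplexOrder

noncomputable def evalC {n : ℕ} (P : MvPolynomial (Fin n) ℂ) (x : Fin n → ℝ) : ℂ :=
  MvPolynomial.aeval (fun i => (x i : ℂ)) P

noncomputable def starC {n : ℕ} (P : MvPolynomial (Fin n) ℂ) : MvPolynomial (Fin n) ℂ :=
  MvPolynomial.map (starRingEnd ℂ) P

def IsPosDefC {n : ℕ} (Λ : MvPolynomial (Fin n) ℂ →ₗ[ℂ] ℂ) : Prop :=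
  ∀ P : MvPolynomial (Fin n) ℂ, 0 ≤ Λ (starC P * P)

def IsMomentC {n : ℕ} (Λ : MvPolynomial (Fin n) ℂ →ₗ[ℂ] ℂ) : Prop :=
  ∃ μ : Measure (Fin n → ℝ),
    (∀ Q : MvPolynomial (Fin n) ℂ, Integrable (fun x => evalC Q x) μ) ∧
    (∀ Q : MvPolynomial (Fin n) ℂ, Λ Q = ∫ x, evalC Q x ∂μ)

noncomputable def vanishingIdealC {n : ℕ} (Z : Set (Fin n → ℝ)) :
    Ideal (MvPolynomial (Fin n) ℂ) where
  carrier := {P | ∀ x ∈ Z, evalC P x = 0}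
  add_mem' := by
    intro a b ha hb x hx
    simp only [Set.mem_setOf_eq, evalC, map_add] at *
    rw [ha x hx, hb x hx, add_zero]
  zero_mem' := by
    intro x hx
    simp [evalC]
  smul_mem' := by
    intro c a ha x hx
    simp only [Set.mem_setOf_eq, evalC, smul_eq_mul, map_mul] at *
    rw [ha x hx, mul_zero]

def zeroSetC {n : ℕ} (I : Ideal (MvPolynomial (Fin n) ℂ)) : Set (Fin n → ℝ) :=
  {x | ∀ P ∈ I, evalC P x = 0}

def zSetC {n : ℕ} (P : MvPolynomial (Fin n) ℂ) : Set (Fin n → ℝ) :=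
  {x | evalC P x = 0}

def VanishesOnC {n : ℕ} (Λ : MvPolynomial (Fin n) ℂ →ₗ[ℂ] ℂ)
    (I : Ideal (MvPolynomial (Fin n) ℂ)) : Prop :=
  ∀ P ∈ I, Λ P = 0

def nSetC {n : ℕ} (Λ : MvPolynomial (Fin n) ℂ →ₗ[ℂ] ℂ) : Set (MvPolynomial (Fin n) ℂ) :=
  {P | Λ (starC P * P) = 0}

def IsTypeAC {n : ℕ} (P : MvPolynomial (Fin n) ℂ) : Prop :=
  ∀ Λ : MvPolynomial (Fin n) ℂ →ₗ[ℂ] ℂ,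
    IsPosDefC Λ → VanishesOnC Λ (Ideal.span {P}) → IsMomentC Λ

open Polynomial in
theorem AdjoinRoot.exists_closure_sq_of_isSumSq {R : Type*} [Field R] {f : R[X]} (hf : f ≠ 0)
    {z : AdjoinRoot f} (hz : IsSumSq z) :
    ∃ p ∈ AddSubmonoid.closure {q : R[X] | ∃ h : R[X], h.degree < f.degree ∧ q = h * h},
      AdjoinRoot.mk f p = z := by
  induction hz with
  | zero => exact ⟨0, zero_mem _, map_zero _⟩
  | sq_add a _ ih =>
    obtain ⟨p, hp, rfl⟩ := ih
    obtain ⟨g, rfl⟩ := AdjoinRoot.mk_surjective a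
    refine ⟨(g % f) * (g % f) + p, add_mem (AddSubmonoid.subset_closure
      ⟨g % f, EuclideanDomain.mod_lt g hf, rfl⟩) hp, ?_⟩
    have : AdjoinRoot.mk f (g % f) = AdjoinRoot.mk f g := by
      rw [AdjoinRoot.mk_eq_mk]
      exact ⟨-(g / f), by linear_combination EuclideanDomain.div_add_mod g f⟩
    rw [map_add, map_mul, this]

open Polynomial in
theorem Polynomial.exists_mul_eq_one_add_of_not_isSemireal {R : Type*} [Field R] {f : R[X]}
    (hf : f ≠ 0) (h : ¬ IsSemireal (AdjoinRoot f)) :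
    ∃ p ∈ AddSubmonoid.closure {q : R[X] | ∃ h : R[X], h.degree < f.degree ∧ q = h * h},
      ∃ q, f * q = 1 + p := by
  rw [isSemireal_iff_not_isSumSq_neg_one, not_not] at h
  obtain ⟨p, hp, h⟩ := AdjoinRoot.exists_closure_sq_of_isSumSq hf h
  have : AdjoinRoot.mk f (1 + p) = 0 := by simp [h]
  obtain ⟨q, hq⟩ := AdjoinRoot.mk_eq_zero.1 this
  exact ⟨p, hp, q, hq.symm⟩

open Polynomial in
theorem Polynomial.isSumSq_eval_of_mem_closure {R : Type*} [Field R] {f p : R[X]}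
    (hp : p ∈ AddSubmonoid.closure {q : R[X] | ∃ h : R[X], h.degree < f.degree ∧ q = h * h})
    (x : R) : IsSumSq (p.eval x) := by
  induction hp using AddSubmonoid.closure_induction with
  | mem q hq => obtain ⟨h, -, rfl⟩ := hq; simp
  | zero => simp
  | add p q _ _ hp hq => rw [eval_add]; exact hp.add hq

open Polynomial in
theorem Polynomial.coeff_two_mul_of_mem_closure {R : Type*} [Field R] {f p : R[X]} {n : ℕ}
    (hf : f.natDegree ≤ n + 1)
    (hp : p ∈ AddSubmonoid.closure {q : R[X] | ∃ h : R[X], h.degree < f.degree ∧ q = h * h}) :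
    p.natDegree ≤ n + n ∧ IsSumSq (p.coeff (n + n)) := by
  induction hp using AddSubmonoid.closure_induction with
  | mem q hq =>
    obtain ⟨h, hh, rfl⟩ := hq
    have hn : h.natDegree ≤ n := by
      by_cases h0 : h = 0
      · simp [h0]
      · have := natDegree_lt_natDegree h0 hh
        lia
    refine ⟨natDegree_mul_le_of_le hn hn, ?_⟩
    rw [coeff_mul_add_eq_of_natDegree_le hn hn]
    exact IsSumSq.mul_self _
  | zero => simp
  | add p q _ _ hp hq =>
    refine ⟨natDegree_add_le_of_degree_le hp.1 hq.1, ?_⟩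
    rw [coeff_add]
    exact hp.2.add hq.2

theorem IsSumSq.inv {R : Type*} [Field R] {a : R} (ha : IsSumSq a) : IsSumSq a⁻¹ := by
  by_cases h : a = 0
  · simp [h]
  · have : a⁻¹ = a * (a⁻¹ * a⁻¹) := by field_simp
    rw [this]
    exact ha.mul (IsSumSq.mul_self _)

open Polynomial in
/-- A field has no proper semireal extension generated by one element. -/
def NoSemirealExtension (R : Type*) [Field R] : Prop :=
  ∀ f : R[X], Irreducible f → IsSemireal (AdjoinRoot f) → ∃ r, f.IsRoot r

/-- The intermediate value property for polynomials. -/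
def PolyIVT (S : Type*) [Field S] [LinearOrder S] : Prop :=
  ∀ (P : Polynomial S) (a b : S), a ≤ b → P.eval a ≤ 0 → 0 ≤ P.eval b →
    ∃ c ∈ Set.Icc a b, P.eval c = 0

open Polynomial in
theorem NoSemirealExtension.isSquare_or_isSumSq_neg {R : Type*} [Field R] [IsSemireal R]
    (hR : NoSemirealExtension R) (a : R) : IsSquare a ∨ IsSumSq (-a) := by
  by_contra! h
  obtain ⟨ha, hna⟩ := h
  have hdeg : (X ^ 2 - C a : R[X]).natDegree = 2 := natDegree_X_pow_sub_C
  have hroot : ∀ r, ¬ (X ^ 2 - C a : R[X]).IsRoot r := fun r hr => ha ⟨r, by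
    simp only [IsRoot, eval_sub, eval_pow, eval_X, eval_C] at hr
    linear_combination -hr⟩
  have hirr : Irreducible (X ^ 2 - C a : R[X]) := by
    rw [irreducible_iff_roots_eq_zero_of_degree_le_three (by lia) (by lia)]
    exact Multiset.eq_zero_of_forall_notMem fun r hr => hroot r (isRoot_of_mem_roots hr)
  obtain ⟨p, hp, q, hq⟩ := exists_mul_eq_one_add_of_not_isSemireal hirr.ne_zero
    fun hs => (hR _ hirr hs).elim hroot
  obtain ⟨hpd, hpc⟩ := coeff_two_mul_of_mem_closure (n := 1) (by lia) hp
  have h1 : (1 + p).natDegree ≤ 2 := natDegree_add_le_of_degree_le (by simp) hpd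
  have hq0 : q ≠ 0 := by
    rintro rfl
    have := congrArg (eval 0) hq
    simp only [mul_zero, eval_zero, eval_add, eval_one] at this
    exact IsSemireal.one_add_ne_zero (isSumSq_eval_of_mem_closure hp 0) this.symm
  rw [← hq, natDegree_mul hirr.ne_zero hq0, hdeg] at h1
  obtain ⟨c, rfl⟩ := natDegree_eq_zero.1 (show q.natDegree = 0 by lia)
  have hc : c = p.coeff 2 := by
    have := congrArg (fun p => coeff p 2) hq
    simpa [coeff_one, coeff_C] using this
  have h2 := congrArg (eval 0) hq
  simp only [eval_mul, eval_sub, eval_pow, eval_X, eval_C, eval_add, eval_one] at h2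
  have hc0 : c ≠ 0 := by rintro rfl; simp at hq0
  apply hna
  have : -a = (1 + p.eval 0) * c⁻¹ := by field_simp; linear_combination h2
  rw [this]
  refine IsSumSq.mul (IsSumSq.add IsSumSq.one (isSumSq_eval_of_mem_closure hp 0)) ?_
  rw [hc]
  exact IsSumSq.inv hpc

theorem NoSemirealExtension.exists_linearOrder {R : Type*} [Field R] [IsSemireal R]
    (hR : NoSemirealExtension R) : ∃ _ : LinearOrder R, IsStrictOrderedRing R := by
  classical
  let C : RingCone R :=
    { Subsemiring.sumSq R with
      eq_zero_of_mem_of_neg_mem' := by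
        intro a ha hna
        replace ha : IsSumSq a := Subsemiring.mem_sumSq.1 ha
        replace hna : IsSumSq (-a) := Subsemiring.mem_sumSq.1 hna
        by_contra h0
        refine IsSemireal.not_isSumSq_neg_one R ?_
        have : (-1 : R) = -a * a⁻¹ := by field_simp
        rw [this]
        exact hna.mul ha.inv }
  have : HasMemOrNegMem C := ⟨fun a => by
    obtain h | h := hR.isSquare_or_isSumSq_neg a
    · exact Or.inl (Subsemiring.mem_sumSq.2 h.isSumSq)
    · exact Or.inr (Subsemiring.mem_sumSq.2 h)⟩
  let := LinearOrder.mkOfAddGroupCone C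
  have := IsOrderedRing.mkOfCone C
  exact ⟨inferInstance, IsOrderedRing.toIsStrictOrderedRing R⟩

open Polynomial in
theorem NoSemirealExtension.polyIVT {R : Type*} [Field R] [LinearOrder R] [IsStrictOrderedRing R]
    (hR : NoSemirealExtension R) : PolyIVT R := by
  suffices H : ∀ n, ∀ (P : R[X]), P.natDegree < n → ∀ a b : R, a ≤ b → P.eval a ≤ 0 →
      0 ≤ P.eval b → ∃ c ∈ Set.Icc a b, P.eval c = 0 from
    fun P => H _ P (Nat.lt_succ_self _)
  intro n
  induction n with
  | zero => intro P hP; lia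
  | succ n ih =>
    intro P hP a b hab ha hb
    rcases ha.eq_or_lt with ha | ha
    · exact ⟨a, ⟨le_rfl, hab⟩, ha⟩
    rcases hb.eq_or_lt with hb | hb
    · exact ⟨b, ⟨hab, le_rfl⟩, hb.symm⟩
    have hP0 : P ≠ 0 := by rintro rfl; simp at ha
    have hPu : ¬ IsUnit P := by
      intro h
      obtain ⟨c, -, rfl⟩ := Polynomial.isUnit_iff.1 h
      simp only [eval_C] at ha hb
      exact ha.not_gt hb
    by_cases hirr : Irreducible P
    · by_cases hs : IsSemireal (AdjoinRoot P)
      · obtain ⟨r, hr⟩ := hR P hirr hs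
        refine ⟨r, ?_, hr⟩
        have hd := degree_eq_one_of_irreducible_of_root hirr hr
        obtain ⟨u, v, hP⟩ := exists_eq_X_add_C_of_natDegree_le_one (natDegree_le_iff_degree_le.2 hd.le)
        rw [hP] at ha hb hr
        simp only [IsRoot, eval_add, eval_mul, eval_C, eval_X] at ha hb hr
        have hu : 0 < u := by
          by_contra! hu
          nlinarith
        constructor
        · by_contra! h
          nlinarith
        · by_contra! h
          nlinarith
      · obtain ⟨p, hp, q, hq⟩ := exists_mul_eq_one_add_of_not_isSemireal hirr.ne_zero hs
        have hpos : ∀ x, 0 < P.eval x * q.eval x := by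
          intro x
          have := congrArg (eval x) hq
          rw [eval_mul, eval_add, eval_one] at this
          rw [this]
          have := (isSumSq_eval_of_mem_closure hp x).nonneg
          linarith
        have hq0 : q ≠ 0 := by
          rintro rfl
          simpa using hpos 0
        have hd := hirr.natDegree_pos
        obtain ⟨hpd, -⟩ := coeff_two_mul_of_mem_closure (n := P.natDegree - 1) (by lia) hp
        have h1 : (1 + p).natDegree ≤ P.natDegree - 1 + (P.natDegree - 1) :=
          natDegree_add_le_of_degree_le (by simp) hpd
        rw [← hq, natDegree_mul hirr.ne_zero hq0] at h1
        obtain ⟨c, -, hc⟩ := ih q (by lia) a b hab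
          (by by_contra!; nlinarith [hpos a]) (by by_contra!; nlinarith [hpos b])
        have := hpos c
        simp [hc] at this
    · obtain ⟨g, h, hg, hh, rfl⟩ : ∃ g h : R[X], ¬ IsUnit g ∧ ¬ IsUnit h ∧ P = g * h := by
        rw [irreducible_iff] at hirr
        push Not at hirr
        obtain ⟨g, h, e, hg, hh⟩ := hirr hPu
        exact ⟨g, h, hg, hh, e⟩
      have hg0 := left_ne_zero_of_mul hP0
      have hh0 := right_ne_zero_of_mul hP0
      have key : ∀ g : R[X], g.natDegree < n → g.eval a * g.eval b ≤ 0 →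
          ∃ c ∈ Set.Icc a b, g.eval c = 0 := by
        intro g hg h
        rcases mul_nonpos_iff.1 h with h | h
        · obtain ⟨c, hc, h⟩ := ih (-g) (by rwa [natDegree_neg]) a b hab
            (by simpa using h.1) (by simpa using h.2)
          exact ⟨c, hc, by simpa using h⟩
        · exact ih g hg a b hab h.1 h.2
      have hgd : 0 < g.natDegree := by
        by_contra! hc
        obtain ⟨c, rfl⟩ := natDegree_eq_zero.1 (Nat.le_zero.1 hc)
        exact hg (isUnit_C.2 (isUnit_iff_ne_zero.2 (by simpa using hg0)))
      have hhd : 0 < h.natDegree := by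
        by_contra! hc
        obtain ⟨c, rfl⟩ := natDegree_eq_zero.1 (Nat.le_zero.1 hc)
        exact hh (isUnit_C.2 (isUnit_iff_ne_zero.2 (by simpa using hh0)))
      rw [natDegree_mul hg0 hh0] at hP
      rw [eval_mul] at ha hb
      by_cases hs : g.eval a * g.eval b ≤ 0
      · obtain ⟨c, hc, h⟩ := key g (by lia) hs
        exact ⟨c, hc, by rw [eval_mul, h, zero_mul]⟩
      · obtain ⟨c, hc, h⟩ := key h (by lia) (by
          push Not at hs
          by_contra! h'
          have := mul_pos hs h'
          have := mul_neg_of_neg_of_pos ha hb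
          nlinarith)
        exact ⟨c, hc, by rw [eval_mul, h, mul_zero]⟩

theorem AddSubmonoid.exists_mem_closure_sq_of_isChain {K : Type*} [Field K] {c : Set (Subfield K)}
    (hc : IsChain (· ≤ ·) c) (hne : c.Nonempty) {z : K}
    (hz : z ∈ AddSubmonoid.closure {x | ∃ y ∈ sSup c, x = y * y}) :
    ∃ F ∈ c, z ∈ AddSubmonoid.closure {x | ∃ y ∈ F, x = y * y} := by
  induction hz using AddSubmonoid.closure_induction with
  | mem x hx =>
    obtain ⟨y, hy, rfl⟩ := hx
    obtain ⟨F, hF, hy⟩ := (Subfield.mem_sSup_of_directedOn hne hc.directedOn).1 hy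
    exact ⟨F, hF, AddSubmonoid.subset_closure ⟨y, hy, rfl⟩⟩
  | zero => exact ⟨hne.some, hne.some_mem, zero_mem _⟩
  | add x y _ _ hx hy =>
    obtain ⟨F, hF, hx⟩ := hx
    obtain ⟨G, hG, hy⟩ := hy
    obtain h | h := hc.total hF hG
    · refine ⟨G, hG, add_mem (AddSubmonoid.closure_mono ?_ hx) hy⟩
      rintro _ ⟨y, hy, e⟩
      exact ⟨y, h hy, e⟩
    · refine ⟨F, hF, add_mem hx (AddSubmonoid.closure_mono ?_ hy)⟩
      rintro _ ⟨y, hy, e⟩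
      exact ⟨y, h hy, e⟩

theorem AddSubmonoid.mem_closure_sq_range_iff {K R : Type*} [Field K] [Field R] (φ : R →+* K)
    {z : K} : z ∈ AddSubmonoid.closure {x | ∃ y ∈ φ.fieldRange, x = y * y} ↔
      ∃ r, IsSumSq r ∧ φ r = z := by
  constructor
  · intro hz
    induction hz using AddSubmonoid.closure_induction with
    | mem x hx =>
      obtain ⟨_, ⟨r, rfl⟩, rfl⟩ := hx
      exact ⟨r * r, IsSumSq.mul_self r, map_mul _ _ _⟩
    | zero => exact ⟨0, IsSumSq.zero, map_zero _⟩
    | add x y _ _ hx hy =>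
      obtain ⟨r, hr, rfl⟩ := hx
      obtain ⟨s, hs, rfl⟩ := hy
      exact ⟨r + s, hr.add hs, map_add _ _ _⟩
  · rintro ⟨r, hr, rfl⟩
    induction hr with
    | zero => rw [map_zero]; exact zero_mem _
    | sq_add a _ ih =>
      rw [map_add, map_mul]
      exact add_mem (AddSubmonoid.subset_closure ⟨φ a, ⟨a, rfl⟩, rfl⟩) ih

theorem isSemireal_iff_neg_one_notMem_closure_range {K R : Type*} [Field K] [Field R]
    (φ : R →+* K) :
    IsSemireal R ↔ (-1 : K) ∉ AddSubmonoid.closure {x | ∃ y ∈ φ.fieldRange, x = y * y} := by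
  rw [isSemireal_iff_not_isSumSq_neg_one, AddSubmonoid.mem_closure_sq_range_iff, not_iff_not]
  constructor
  · intro h
    exact ⟨-1, h, by simp⟩
  · rintro ⟨r, hr, h⟩
    have : r = -1 := φ.injective (by simpa using h)
    rwa [← this]

/-- Every semireal field embeds into an ordered field with the polynomial intermediate value
property. -/
theorem IsSemireal.exists_polyIVT (K : Type) [Field K] [IsSemireal K] :
    ∃ (S : Type) (_ : Field S) (_ : LinearOrder S) (_ : IsStrictOrderedRing S),
      PolyIVT S ∧ Nonempty (K →+* S) := by
  let Ω := AlgebraicClosure K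
  let P : Set (Subfield Ω) := {F | (-1 : Ω) ∉ AddSubmonoid.closure {x | ∃ y ∈ F, x = y * y}}
  let φ : K →+* Ω := algebraMap K Ω
  have hφ : φ.fieldRange ∈ P := (isSemireal_iff_neg_one_notMem_closure_range φ).1 inferInstance
  obtain ⟨R, hKR, hR⟩ := zorn_le_nonempty₀ P (by
    intro c hcP hc F hF
    refine ⟨sSup c, fun h => ?_, fun _ => le_sSup⟩
    obtain ⟨G, hG, h⟩ := AddSubmonoid.exists_mem_closure_sq_of_isChain hc ⟨F, hF⟩ h
    exact hcP hG h) _ hφ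
  have hRr : R.subtype.fieldRange = R := by
    ext x
    simp
  have : IsSemireal R := by
    rw [isSemireal_iff_neg_one_notMem_closure_range R.subtype, hRr]
    exact hR.prop
  have hN : NoSemirealExtension R := by
    intro f hf hs
    have : Fact (Irreducible f) := ⟨hf⟩
    obtain ⟨α, hα⟩ := IsAlgClosed.exists_eval₂_eq_zero R.subtype f
      (Polynomial.degree_pos_of_irreducible hf).ne'
    let ψ : AdjoinRoot f →+* Ω := AdjoinRoot.lift R.subtype α hα
    have h1 : ψ.fieldRange ∈ P := (isSemireal_iff_neg_one_notMem_closure_range ψ).1 hs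
    have h2 : R ≤ ψ.fieldRange := fun x hx =>
      ⟨AdjoinRoot.of f ⟨x, hx⟩, by simp only [ψ, AdjoinRoot.lift_of]; rfl⟩
    have h3 : α ∈ R := hR.le_of_ge h1 h2 ⟨AdjoinRoot.root f, by simp [ψ]⟩
    refine ⟨⟨α, h3⟩, R.subtype.injective ?_⟩
    rw [← Polynomial.eval₂_hom, map_zero]
    exact hα
  obtain ⟨_, _⟩ := hN.exists_linearOrder
  exact ⟨R, inferInstance, inferInstance, inferInstance, hN.polyIVT,
    ⟨φ.codRestrict R fun x => hKR ⟨x, rfl⟩⟩⟩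

section PolyIVT

open Polynomial

variable {S : Type*} [Field S] [LinearOrder S] [IsStrictOrderedRing S]

theorem PolyIVT.exists_root_of_mul_nonpos (hS : PolyIVT S) {P : S[X]} {a b : S} (hab : a ≤ b)
    (h : P.eval a * P.eval b ≤ 0) : ∃ c ∈ Set.Icc a b, P.eval c = 0 := by
  rcases mul_nonpos_iff.1 h with h | h
  · obtain ⟨c, hc, h⟩ := hS (-P) a b hab (by simpa using h.1) (by simpa using h.2)
    exact ⟨c, hc, by simpa using h⟩
  · exact hS P a b hab h.1 h.2

theorem PolyIVT.mul_pos_of_forall_ne (hS : PolyIVT S) {P : S[X]} {a b : S} (hab : a ≤ b)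
    (h : ∀ c ∈ Set.Icc a b, P.eval c ≠ 0) : 0 < P.eval a * P.eval b := by
  by_contra! h'
  obtain ⟨c, hc, h'⟩ := hS.exists_root_of_mul_nonpos hab h'
  exact h c hc h'

theorem PolyIVT.pos_iff_of_forall_ne (hS : PolyIVT S) {P : S[X]} {a b : S}
    (h : ∀ c ∈ Set.uIcc a b, P.eval c ≠ 0) : 0 < P.eval a ↔ 0 < P.eval b := by
  have : 0 < P.eval a * P.eval b := by
    rcases le_total a b with hab | hab
    · rw [Set.uIcc_of_le hab] at h
      exact hS.mul_pos_of_forall_ne hab h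
    · rw [Set.uIcc_of_ge hab] at h
      rw [mul_comm]
      exact hS.mul_pos_of_forall_ne hab h
  exact ⟨fun h => (mul_pos_iff_of_pos_left h).1 this, fun h => (mul_pos_iff_of_pos_right h).1 this⟩

/-- The theorem of Rolle for polynomials. -/
theorem PolyIVT.exists_derivative_eq_zero (hS : PolyIVT S) {P : S[X]} {a b : S} (hab : a < b)
    (ha : P.eval a = 0) (hb : P.eval b = 0) : ∃ c ∈ Set.Icc a b, P.derivative.eval c = 0 := by
  by_cases hP : P = 0
  · exact ⟨a, ⟨le_rfl, hab.le⟩, by simp [hP]⟩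
  obtain ⟨b', hb', hmin⟩ := (P.roots.toFinset.filter (a < ·)).exists_min_image id
    ⟨b, by simp [hP, hb, hab]⟩
  simp only [Finset.mem_filter, Multiset.mem_toFinset, mem_roots hP, IsRoot, id] at hb' hmin
  obtain ⟨hb'0, hab'⟩ := hb'
  have hb'b : b' ≤ b := hmin b ⟨hb, hab⟩
  suffices H : ∃ c ∈ Set.Icc a b', P.derivative.eval c = 0 by
    obtain ⟨c, hc, h⟩ := H
    exact ⟨c, ⟨hc.1, hc.2.trans hb'b⟩, h⟩
  obtain ⟨Q, rfl⟩ := dvd_iff_isRoot.2 ha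
  obtain ⟨R, rfl⟩ : X - C b' ∣ Q := dvd_iff_isRoot.2 (by
    rw [eval_mul, eval_sub, eval_X, eval_C] at hb'0
    exact (mul_eq_zero.1 hb'0).resolve_left (sub_ne_zero.2 hab'.ne'))
  have hda : ((X - C a) * ((X - C b') * R)).derivative.eval a = (a - b') * R.eval a := by
    simp [derivative_mul]
  have hdb : ((X - C a) * ((X - C b') * R)).derivative.eval b' = (b' - a) * R.eval b' := by
    simp [derivative_mul]
  by_cases hRa : R.eval a = 0
  · exact ⟨a, ⟨le_rfl, hab'.le⟩, by rw [hda, hRa, mul_zero]⟩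
  by_cases hRb : R.eval b' = 0
  · exact ⟨b', ⟨hab'.le, le_rfl⟩, by rw [hdb, hRb, mul_zero]⟩
  have hpos : 0 < R.eval a * R.eval b' := by
    refine hS.mul_pos_of_forall_ne hab'.le fun c hc h => ?_
    have hac : a < c := lt_of_le_of_ne hc.1 (by rintro rfl; exact hRa h)
    have := hmin c ⟨by rw [eval_mul, eval_mul, h, mul_zero, mul_zero], hac⟩
    have := le_antisymm hc.2 this
    subst this
    exact hRb h
  refine hS.exists_root_of_mul_nonpos hab'.le ?_
  rw [hda, hdb]
  have := mul_nonneg (mul_self_nonneg (b' - a)) hpos.le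
  linarith

theorem PolyIVT.mul_neg_of_derivative_ne (hS : PolyIVT S) {P : S[X]} {a b c : S} (hac : a < c)
    (hcb : c < b) (hc : P.eval c = 0) (ha : P.eval a ≠ 0) (hb : P.eval b ≠ 0)
    (h : ∀ x ∈ Set.Ioo a b, P.derivative.eval x ≠ 0) : P.eval a * P.eval b < 0 := by
  obtain ⟨Q, rfl⟩ := dvd_iff_isRoot.2 hc
  have hQ : 0 < Q.eval a * Q.eval b := by
    refine hS.mul_pos_of_forall_ne (hac.trans hcb).le fun x hx hQx => ?_
    have hx0 : ((X - C c) * Q).eval x = 0 := by rw [eval_mul, hQx, mul_zero]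
    have hax : a < x := lt_of_le_of_ne hx.1 (by rintro rfl; exact ha hx0)
    have hxb : x < b := lt_of_le_of_ne hx.2 (by rintro rfl; exact hb hx0)
    rcases lt_trichotomy c x with hcx | rfl | hcx
    · obtain ⟨y, hy, h0⟩ := hS.exists_derivative_eq_zero hcx hc hx0
      exact h y ⟨hac.trans_le hy.1, hy.2.trans_lt hxb⟩ h0
    · exact h c ⟨hac, hcb⟩ (by simp [derivative_mul, hQx])
    · obtain ⟨y, hy, h0⟩ := hS.exists_derivative_eq_zero hcx hx0 hc
      exact h y ⟨hax.trans_le hy.1, hy.2.trans_lt hcb⟩ h0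
  simp only [eval_mul, eval_sub, eval_X, eval_C]
  have := mul_pos (mul_pos (sub_pos.2 hac) (sub_pos.2 hcb)) hQ
  linarith

end PolyIVT

open Polynomial in
/-- A pair of embeddings of a common ring into two ordered fields, inducing the same order, which
cannot be extended to a larger ring. -/
structure IsMaximalPair {M S T : Type*} [CommRing M] [Field S] [LinearOrder S] [Field T]
    [LinearOrder T] (i : M →+* S) (j : M →+* T) : Prop where
  inj : ∀ m, i m = 0 → m = 0
  pos : ∀ m, 0 < i m ↔ 0 < j m
  ext : ∀ α β, (∀ g : M[X], 0 < g.eval₂ i α ↔ 0 < g.eval₂ j β) → ∃ m, i m = α ∧ j m = β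

namespace IsMaximalPair

open Polynomial

variable {M S T : Type*} [CommRing M] [Field S] [LinearOrder S] [Field T] [LinearOrder T]
  {i : M →+* S} {j : M →+* T}

theorem injective (h : IsMaximalPair i j) : Function.Injective i :=
  (injective_iff_map_eq_zero i).2 h.inj

/-- A gap of the common ring around `α` contains no roots of polynomials with roots in the ring. -/
theorem exists_Ioo_forall_ne {α : S} (hα : ∀ m, i m ≠ α) {G : M[X]} (hi : Function.Injective i)
    (hG : G ≠ 0) (hroots : ∀ x, G.eval₂ i x = 0 → ∃ m, i m = x) {lo hi : M} (hlo : i lo < α)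
    (hhi : α < i hi) : ∃ a b, i a < α ∧ α < i b ∧ ∀ x ∈ Set.Ioo (i a) (i b), G.eval₂ i x ≠ 0 := by
  have hGi : G.map i ≠ 0 := (Polynomial.map_ne_zero_iff ‹_›).2 hG
  have hmem : ∀ x, x ∈ (G.map i).roots.toFinset ↔ G.eval₂ i x = 0 := by
    intro x
    rw [Multiset.mem_toFinset, mem_roots hGi, IsRoot, eval_map]
  obtain ⟨r, hr, hmax⟩ := ((insert (i lo) (G.map i).roots.toFinset).filter (· < α)).exists_max_image
    id ⟨i lo, by simp [hlo]⟩
  obtain ⟨s, hs, hmin⟩ := ((insert (i hi) (G.map i).roots.toFinset).filter (α < ·)).exists_min_image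
    id ⟨i hi, by simp [hhi]⟩
  simp only [Finset.mem_filter, Finset.mem_insert, hmem, id] at hr hmax hs hmin
  obtain ⟨a, rfl⟩ : ∃ a, i a = r := hr.1.elim (fun h => ⟨lo, h.symm⟩) (hroots r)
  obtain ⟨b, rfl⟩ : ∃ b, i b = s := hs.1.elim (fun h => ⟨hi, h.symm⟩) (hroots s)
  refine ⟨a, b, hr.2, hs.2, fun x hx h0 => ?_⟩
  rcases lt_trichotomy x α with hxα | rfl | hxα
  · exact hx.1.not_ge (hmax x ⟨Or.inr h0, hxα⟩)
  · obtain ⟨m, hm⟩ := hroots _ h0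
    exact hα m hm
  · exact hx.2.not_ge (hmin x ⟨Or.inr h0, hxα⟩)

variable [IsStrictOrderedRing S] [IsStrictOrderedRing T]

theorem neg_iff (h : IsMaximalPair i j) (m : M) : i m < 0 ↔ j m < 0 := by
  simpa using h.pos (-m)

theorem eq_zero_iff (h : IsMaximalPair i j) (m : M) : i m = 0 ↔ j m = 0 := by
  have h1 := h.pos m
  have h2 := h.neg_iff m
  constructor <;> intro h0 <;> rw [h0] at h1 h2 <;>
    simp only [lt_irrefl, iff_false, false_iff] at h1 h2 <;>
    exact le_antisymm (not_lt.1 h1) (not_lt.1 h2)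

theorem lt_iff (h : IsMaximalPair i j) (a b : M) : i a < i b ↔ j a < j b := by
  simpa using h.pos (b - a)

theorem symm (h : IsMaximalPair i j) : IsMaximalPair j i where
  inj m hm := h.inj m ((h.eq_zero_iff m).2 hm)
  pos m := (h.pos m).symm
  ext α β hg := by
    obtain ⟨m, h1, h2⟩ := h.ext β α fun g => (hg g).symm
    exact ⟨m, h2, h1⟩

theorem _root_.Polynomial.eval₂_inv_pos_iff {M F : Type*} [CommRing M] [Field F] [LinearOrder F]
    [IsStrictOrderedRing F] (k : M →+* F) {m : M} (hk : k m ≠ 0) (g : M[X]) :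
    0 < g.eval₂ k (k m)⁻¹ ↔ 0 < k (g.reverse.eval m * m ^ g.natDegree) := by
  have key := @eval₂_reverse_mul_pow _ _ _ _ k (k m)⁻¹
    ⟨k m, mul_inv_cancel₀ hk, inv_mul_cancel₀ hk⟩ g
  change g.reverse.eval₂ k (k m) * _ = _ at key
  rw [← key, eval₂_hom, map_mul, map_pow, inv_pow]
  generalize k (g.reverse.eval m) = x
  have hy : k m ^ g.natDegree ≠ 0 := pow_ne_zero _ hk
  generalize k m ^ g.natDegree = y at hy
  have h2 : 0 < y ^ 2 := by positivity
  rw [show x * y = x * y⁻¹ * y ^ 2 by field_simp, mul_pos_iff_of_pos_right h2]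

theorem exists_inv (h : IsMaximalPair i j) {m : M} (hm : i m ≠ 0) : ∃ m', m * m' = 1 := by
  have hm' : j m ≠ 0 := fun h0 => hm ((h.eq_zero_iff m).2 h0)
  obtain ⟨m', h1, -⟩ := h.ext (i m)⁻¹ (j m)⁻¹ fun g => by
    rw [eval₂_inv_pos_iff i hm, eval₂_inv_pos_iff j hm', h.pos]
  exact ⟨m', h.injective (by rw [map_mul, h1, map_one, mul_inv_cancel₀ hm])⟩

theorem exists_between (h : IsMaximalPair i j) {a b : M} (hab : i a < i b) :
    ∃ m, i a < i m ∧ i m < i b := by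
  obtain ⟨t, ht⟩ := h.exists_inv (m := 2) (by rw [map_ofNat]; exact two_ne_zero)
  have ht' : i t = 2⁻¹ := by
    have := congrArg i ht
    rw [map_mul, map_ofNat, map_one] at this
    field_simp
    linear_combination this
  refine ⟨(a + b) * t, ?_, ?_⟩ <;> rw [map_mul, map_add, ht'] <;> linarith

theorem exists_le_eval₂_of_forall_lt (h : IsMaximalPair i j) {α : S} (hα : ∀ m, i m < α) (n : ℕ) :
    ∀ g : M[X], g.natDegree = n → 0 < i g.leadingCoeff →
      ∃ ε, 0 < i ε ∧ i ε ≤ g.eval₂ i α := by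
  induction n with
  | zero =>
    intro g hg hpos
    obtain ⟨c, rfl⟩ := natDegree_eq_zero.1 hg
    rw [leadingCoeff_C] at hpos
    exact ⟨c, hpos, by rw [eval₂_C]⟩
  | succ n ih =>
    intro g hg hpos
    have hd : g.divX.natDegree = n := by rw [natDegree_divX_eq_natDegree_tsub_one]; lia
    obtain ⟨ε, hε, hle⟩ := ih g.divX hd (by
      rw [leadingCoeff, hd, coeff_divX, ← hg]; exact hpos)
    obtain ⟨δ, hδ⟩ := h.exists_inv hε.ne'
    have hδ' : i ε * i δ = 1 := by rw [← map_mul, hδ, map_one]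
    refine ⟨1, by simp, ?_⟩
    have h0 : 0 < α := by simpa using hα 0
    have h1 := hα ((1 - g.coeff 0) * δ)
    have h2 := mul_le_mul_of_nonneg_right hle h0.le
    have h3 := mul_lt_mul_of_pos_left h1 hε
    conv_rhs => rw [← divX_mul_X_add g]
    rw [eval₂_add, eval₂_mul, eval₂_X, eval₂_C, map_one]
    have h4 : i ε * i ((1 - g.coeff 0) * δ) = 1 - i (g.coeff 0) := by
      rw [map_mul, map_sub, map_one]
      linear_combination (1 - i (g.coeff 0)) * hδ'
    linarith

theorem exists_lt_of_root (h : IsMaximalPair i j) {f : M[X]} (hf : f.Monic) {α : S}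
    (hα : f.eval₂ i α = 0) (hm : ∀ m, i m ≠ α) : ∃ m, α < i m := by
  by_contra! hc
  obtain ⟨ε, h1, h2⟩ := h.exists_le_eval₂_of_forall_lt (fun m => (hc m).lt_of_ne (hm m)) _ f rfl
    (by rw [hf.leadingCoeff, map_one]; exact one_pos)
  rw [hα] at h2
  exact h1.not_ge h2

theorem exists_gt_of_root (h : IsMaximalPair i j) {f : M[X]} (hf : f.Monic) {α : S}
    (hα : f.eval₂ i α = 0) (hm : ∀ m, i m ≠ α) : ∃ m, i m < α := by
  have hu : (C ((-1) ^ f.natDegree) * f.comp (-X)).Monic := by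
    rw [C_pow, C_neg, C_1]
    exact hf.neg_one_pow_natDegree_mul_comp_neg_X
  obtain ⟨m, hm⟩ := h.exists_lt_of_root hu (α := -α) (by
    rw [eval₂_mul, eval₂_comp]; simp [hα]) (fun m h => hm (-m) (by rw [map_neg, h, neg_neg]))
  exact ⟨-m, by rw [map_neg]; linarith⟩

end IsMaximalPair

namespace IsMaximalPair

open Polynomial

variable {M S T : Type*} [CommRing M] [Field S] [LinearOrder S] [IsStrictOrderedRing S]
  [Field T] [LinearOrder T] [IsStrictOrderedRing T] {i : M →+* S} {j : M →+* T}

theorem eval₂_eq_zero_of_monic (h : IsMaximalPair i j) (hS : PolyIVT S) (hT : PolyIVT T) {d : ℕ}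
    (ihS : ∀ g : M[X], g ≠ 0 → g.natDegree ≤ d → ∀ x, g.eval₂ i x = 0 → ∃ m, i m = x)
    (ihT : ∀ g : M[X], g ≠ 0 → g.natDegree ≤ d → ∀ x, g.eval₂ j x = 0 → ∃ m, j m = x)
    {f : M[X]} (hf : f.Monic) (hd : f.natDegree = d + 1) {α : S} (hα : f.eval₂ i α = 0) :
    ∃ m, i m = α := by
  by_contra! hne
  have hi := h.injective
  have hj := h.symm.injective
  have : IsDomain M := hi.isDomain i
  have : CharZero M := by
    refine ⟨fun a b hab => ?_⟩
    have := congrArg i hab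
    rw [map_natCast, map_natCast] at this
    exact_mod_cast this
  have hfm : ∀ m, i (f.eval m) ≠ 0 := by
    intro m hm
    obtain ⟨q, rfl⟩ := dvd_iff_isRoot.2 (h.inj _ hm)
    have hq : q ≠ 0 := by rintro rfl; simp at hd
    rw [eval₂_mul, eval₂_sub, eval₂_X, eval₂_C] at hα
    rw [natDegree_mul (X_sub_C_ne_zero m) hq, natDegree_X_sub_C] at hd
    rcases mul_eq_zero.1 hα with h0 | h0
    · exact hne m (sub_eq_zero.1 h0).symm
    · obtain ⟨m', hm'⟩ := ihS q hq (by lia) α h0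
      exact hne m' hm'
  have hg : ∀ β, ∃ g : M[X], g ≠ 0 ∧ g.natDegree ≤ d ∧
      (f.eval₂ j β = 0 → ¬ (0 < g.eval₂ i α ↔ 0 < g.eval₂ j β)) := by
    intro β
    by_cases hβ : f.eval₂ j β = 0
    · obtain ⟨g, hg⟩ : ∃ g : M[X], ¬ (0 < g.eval₂ i α ↔ 0 < g.eval₂ j β) := by
        by_contra! hc
        obtain ⟨m, hm, -⟩ := h.ext α β hc
        exact hne m hm
      rw [← eval₂_modByMonic_eq_self_of_root hα, ← eval₂_modByMonic_eq_self_of_root hβ] at hg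
      refine ⟨g %ₘ f, ?_, ?_, fun _ => hg⟩
      · intro h0
        rw [h0] at hg
        simp at hg
      · have := natDegree_modByMonic_lt g hf (by rintro rfl; simp at hd)
        lia
    · exact ⟨1, one_ne_zero, by simp, fun h => absurd h hβ⟩
  choose g hg0 hgd hg using hg
  have hf' : f.derivative ≠ 0 := fun h0 => by
    have := derivative_eq_zero.1 h0
    lia
  have hf'd : f.derivative.natDegree ≤ d := by
    have := natDegree_derivative_le f
    lia
  let R := (f.map j).roots.toFinset
  have hR : ∀ β, f.eval₂ j β = 0 → β ∈ R := fun β hβ => by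
    rw [Multiset.mem_toFinset, mem_roots (hf.map j).ne_zero, IsRoot, eval_map]
    exact hβ
  let G := f.derivative * ∏ β ∈ R, g β
  have hG : G ≠ 0 := mul_ne_zero hf' (Finset.prod_ne_zero_iff.2 fun β _ => hg0 β)
  have hGS : ∀ x, G.eval₂ i x = 0 → ∃ m, i m = x := by
    intro x hx
    rw [eval₂_mul, eval₂_finsetProd, mul_eq_zero, Finset.prod_eq_zero_iff] at hx
    rcases hx with hx | ⟨β, -, hx⟩
    · exact ihS _ hf' hf'd x hx
    · exact ihS _ (hg0 β) (hgd β) x hx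
  have hGT : ∀ x, G.eval₂ j x = 0 → ∃ m, j m = x := by
    intro x hx
    rw [eval₂_mul, eval₂_finsetProd, mul_eq_zero, Finset.prod_eq_zero_iff] at hx
    rcases hx with hx | ⟨β, -, hx⟩
    · exact ihT _ hf' hf'd x hx
    · exact ihT _ (hg0 β) (hgd β) x hx
  obtain ⟨lo, hlo⟩ := h.exists_gt_of_root hf hα hne
  obtain ⟨hi', hhi⟩ := h.exists_lt_of_root hf hα hne
  obtain ⟨a, b, haα, hαb, hab⟩ := exists_Ioo_forall_ne hne hi hG hGS hlo hhi
  have habT : ∀ x ∈ Set.Ioo (j a) (j b), G.eval₂ j x ≠ 0 := by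
    intro x hx h0
    obtain ⟨m, rfl⟩ := hGT x h0
    refine hab (i m) ⟨(h.lt_iff _ _).2 hx.1, (h.lt_iff _ _).2 hx.2⟩ ?_
    rw [eval₂_hom] at h0 ⊢
    exact (h.eq_zero_iff _).2 h0
  have hneg : i (f.eval a) * i (f.eval b) < 0 := by
    have := hS.mul_neg_of_derivative_ne (P := f.map i) haα hαb (by rwa [eval_map])
      (by rw [eval_map, eval₂_hom]; exact hfm a) (by rw [eval_map, eval₂_hom]; exact hfm b)
      (fun x hx h0 => hab x hx (by
        rw [derivative_map, eval_map] at h0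
        rw [eval₂_mul, h0, zero_mul]))
    simpa only [eval_map, eval₂_hom] using this
  rw [← map_mul, h.neg_iff, map_mul] at hneg
  have habj : j a < j b := (h.lt_iff _ _).1 (haα.trans hαb)
  obtain ⟨β, hβ, hβ0⟩ := hT.exists_root_of_mul_nonpos (P := f.map j) habj.le
    (by simpa only [eval_map, eval₂_hom] using hneg.le)
  rw [eval_map] at hβ0
  have hfmj : ∀ m, j (f.eval m) ≠ 0 := fun m h0 => hfm m ((h.eq_zero_iff _).2 h0)
  have haβ : j a < β := lt_of_le_of_ne hβ.1 (by
    rintro rfl; rw [eval₂_hom] at hβ0; exact hfmj a hβ0)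
  have hβb : β < j b := lt_of_le_of_ne hβ.2 (by
    rintro rfl; rw [eval₂_hom] at hβ0; exact hfmj b hβ0)
  obtain ⟨m, ham, hmb⟩ := h.exists_between (haα.trans hαb)
  refine hg β hβ0 ?_
  have hdvd : g β ∣ G := (Finset.dvd_prod_of_mem g (hR β hβ0)).mul_left _
  have hgS := hS.pos_iff_of_forall_ne (P := (g β).map i) (a := α) (b := i m) (by
    intro x hx h0
    rw [eval_map] at h0
    exact hab x (Set.ordConnected_Ioo.uIcc_subset ⟨haα, hαb⟩ ⟨ham, hmb⟩ hx)
      (eval₂_eq_zero_of_dvd_of_eval₂_eq_zero i x hdvd h0))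
  have hgT := hT.pos_iff_of_forall_ne (P := (g β).map j) (a := β) (b := j m) (by
    intro x hx h0
    rw [eval_map] at h0
    exact habT x (Set.ordConnected_Ioo.uIcc_subset ⟨haβ, hβb⟩
      ⟨(h.lt_iff _ _).1 ham, (h.lt_iff _ _).1 hmb⟩ hx)
      (eval₂_eq_zero_of_dvd_of_eval₂_eq_zero j x hdvd h0))
  rw [eval_map, eval_map, eval₂_hom] at hgS hgT
  rw [hgS, hgT, h.pos]

theorem exists_eq_of_root_of_ih (h : IsMaximalPair i j) (hS : PolyIVT S) (hT : PolyIVT T) {d : ℕ}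
    (ihS : ∀ g : M[X], g ≠ 0 → g.natDegree ≤ d → ∀ x, g.eval₂ i x = 0 → ∃ m, i m = x)
    (ihT : ∀ g : M[X], g ≠ 0 → g.natDegree ≤ d → ∀ x, g.eval₂ j x = 0 → ∃ m, j m = x)
    {f : M[X]} (hf : f ≠ 0) (hd : f.natDegree ≤ d + 1) {α : S} (hα : f.eval₂ i α = 0) :
    ∃ m, i m = α := by
  rcases hd.lt_or_eq with hd | hd
  · exact ihS f hf (by lia) α hα
  have hi := h.injective
  have : IsDomain M := hi.isDomain i
  obtain ⟨c, hc⟩ := h.exists_inv (m := f.leadingCoeff) fun h0 =>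
    leadingCoeff_ne_zero.2 hf (h.inj _ h0)
  have hc0 : c ≠ 0 := by rintro rfl; simp at hc
  refine h.eval₂_eq_zero_of_monic hS hT ihS ihT (f := f * C c) (by
    rw [Monic, leadingCoeff_mul, leadingCoeff_C, hc]) ?_ (by rw [eval₂_mul, hα, zero_mul])
  rw [natDegree_mul_C hc0, hd]

theorem exists_eq_of_root (h : IsMaximalPair i j) (hS : PolyIVT S) (hT : PolyIVT T) {f : M[X]}
    (hf : f ≠ 0) {α : S} (hα : f.eval₂ i α = 0) : ∃ m, i m = α := by
  have key : ∀ d : ℕ, (∀ g : M[X], g ≠ 0 → g.natDegree ≤ d → ∀ x, g.eval₂ i x = 0 → ∃ m, i m = x) ∧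
      (∀ g : M[X], g ≠ 0 → g.natDegree ≤ d → ∀ x, g.eval₂ j x = 0 → ∃ m, j m = x) := by
    intro d
    induction d with
    | zero =>
      constructor <;> intro g hg hd x hx
      · obtain ⟨c, rfl⟩ := natDegree_eq_zero.1 (Nat.le_zero.1 hd)
        rw [eval₂_C] at hx
        exact absurd (by rw [h.inj c hx, C_0]) hg
      · obtain ⟨c, rfl⟩ := natDegree_eq_zero.1 (Nat.le_zero.1 hd)
        rw [eval₂_C] at hx
        exact absurd (by rw [h.symm.inj c hx, C_0]) hg
    | succ d ih =>
      exact ⟨fun g hg hd x hx => h.exists_eq_of_root_of_ih hS hT ih.1 ih.2 hg hd hx,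
        fun g hg hd x hx => h.symm.exists_eq_of_root_of_ih hT hS ih.2 ih.1 hg hd hx⟩
  exact (key f.natDegree).1 f hf le_rfl α hα

theorem exists_realization (h : IsMaximalPair i j) (hS : PolyIVT S) (hT : PolyIVT T) (s : S)
    (F : Finset M[X]) : ∃ m, ∀ g ∈ F, (0 < g.eval₂ i s ↔ 0 < j (g.eval m)) := by
  classical
  by_cases hs : ∃ m, i m = s
  · obtain ⟨m, rfl⟩ := hs
    exact ⟨m, fun g _ => by rw [eval₂_hom, h.pos]⟩
  push Not at hs
  have hi := h.injective
  have : IsDomain M := hi.isDomain i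
  let G : M[X] := ∏ g ∈ F.filter (· ≠ 0), g
  have hG : G ≠ 0 := Finset.prod_ne_zero_iff.2 fun g hg => (Finset.mem_filter.1 hg).2
  suffices H : ∃ m, ∀ x ∈ Set.uIcc s (i m), G.eval₂ i x ≠ 0 by
    obtain ⟨m, hm⟩ := H
    refine ⟨m, fun g hg => ?_⟩
    by_cases hg0 : g = 0
    · simp [hg0]
    have hdvd : g ∣ G := Finset.dvd_prod_of_mem id (Finset.mem_filter.2 ⟨hg, hg0⟩)
    have := hS.pos_iff_of_forall_ne (P := g.map i) (a := s) (b := i m) (by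
      intro x hx h0
      rw [eval_map] at h0
      exact hm x hx (eval₂_eq_zero_of_dvd_of_eval₂_eq_zero i x hdvd h0))
    rw [eval_map, eval_map, eval₂_hom] at this
    rw [this, h.pos]
  have hmem : ∀ x, x ∈ (G.map i).roots.toFinset ↔ G.eval₂ i x = 0 := by
    intro x
    rw [Multiset.mem_toFinset, mem_roots ((Polynomial.map_ne_zero_iff hi).2 hG), IsRoot, eval_map]
  have hroots : ∀ x, G.eval₂ i x = 0 → ∃ m, i m = x := fun x hx =>
    h.exists_eq_of_root hS hT hG hx
  by_cases hlo : ∃ lo, i lo < s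
  · by_cases hhi : ∃ hi, s < i hi
    · obtain ⟨lo, hlo⟩ := hlo
      obtain ⟨hi', hhi⟩ := hhi
      obtain ⟨a, b, ha, hb, hab⟩ := exists_Ioo_forall_ne hs hi hG hroots hlo hhi
      obtain ⟨m, ham, hmb⟩ := h.exists_between (ha.trans hb)
      exact ⟨m, fun x hx => hab x (Set.ordConnected_Ioo.uIcc_subset ⟨ha, hb⟩ ⟨ham, hmb⟩ hx)⟩
    · push Not at hhi
      obtain ⟨r, hr, hmax⟩ := (insert 0 (G.map i).roots.toFinset).exists_max_image
        id ⟨0, by simp⟩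
      simp only [Finset.mem_insert, hmem, id] at hr hmax
      obtain ⟨a, rfl⟩ : ∃ a, i a = r := hr.elim (fun h => ⟨0, by rw [h, map_zero]⟩) (hroots r)
      refine ⟨a + 1, fun x hx h0 => ?_⟩
      have := hmax x (Or.inr h0)
      rw [Set.uIcc_of_ge (hhi _), map_add, map_one] at hx
      linarith [hx.1]
  · push Not at hlo
    obtain ⟨r, hr, hmin⟩ := (insert 0 (G.map i).roots.toFinset).exists_min_image
      id ⟨0, by simp⟩
    simp only [Finset.mem_insert, hmem, id] at hr hmin
    obtain ⟨a, rfl⟩ : ∃ a, i a = r := hr.elim (fun h => ⟨0, by rw [h, map_zero]⟩) (hroots r)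
    refine ⟨a - 1, fun x hx h0 => ?_⟩
    have := hmin x (Or.inr h0)
    rw [Set.uIcc_of_le (hlo _), map_sub, map_one] at hx
    linarith [hx.2]

end IsMaximalPair

section Consistent

open Polynomial

/-- The subring `L` of `S × T` is the graph of an order-preserving relation. -/
def IsConsistent {S T : Type*} [Field S] [LinearOrder S] [Field T] [LinearOrder T]
    (L : Subring (S × T)) : Prop :=
  ∀ p ∈ L, 0 < p.1 ↔ 0 < p.2

theorem IsConsistent.exists_le_maximal {S T : Type*} [Field S] [LinearOrder S] [Field T]
    [LinearOrder T] {L : Subring (S × T)} (hL : IsConsistent L) :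
    ∃ M, L ≤ M ∧ Maximal IsConsistent M := by
  refine zorn_le_nonempty₀ {M | IsConsistent M} (fun c hc hchain y hy => ?_) L hL
  refine ⟨sSup c, fun p hp => ?_, fun z hz => le_sSup hz⟩
  obtain ⟨N, hN, hpN⟩ := (Subring.mem_sSup_of_directedOn ⟨y, hy⟩ hchain.directedOn).1 hp
  exact hc hN p hpN

theorem IsConsistent.snd_eq_zero {S T : Type*} [Field S] [LinearOrder S] [IsStrictOrderedRing S]
    [Field T] [LinearOrder T] [IsStrictOrderedRing T] {L : Subring (S × T)} (hL : IsConsistent L)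
    {p : S × T} (hp : p ∈ L) (h0 : p.1 = 0) : p.2 = 0 := by
  have h1 := hL p hp
  have h2 := hL (-p) (neg_mem hp)
  simp only [h0, Prod.fst_neg, Prod.snd_neg, neg_zero, lt_irrefl, false_iff, neg_pos,
    not_lt] at h1 h2
  exact le_antisymm h1 h2

theorem IsConsistent.isMaximalPair {S T : Type*} [Field S] [LinearOrder S] [IsStrictOrderedRing S]
    [Field T] [LinearOrder T] [IsStrictOrderedRing T] {M : Subring (S × T)}
    (hM : Maximal IsConsistent M) :
    IsMaximalPair ((RingHom.fst S T).comp M.subtype) ((RingHom.snd S T).comp M.subtype) where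
  inj m hm := by
    change (m : S × T).1 = 0 at hm
    exact Subtype.ext (Prod.ext hm (hM.prop.snd_eq_zero m.2 hm))
  pos m := hM.prop m m.2
  ext α β hg := by
    let N := (eval₂RingHom M.subtype (α, β)).range
    have hN : IsConsistent N := by
      rintro _ ⟨g, rfl⟩
      have := hg g
      rw [← RingHom.coe_fst, ← RingHom.coe_snd, coe_eval₂RingHom, hom_eval₂, hom_eval₂]
      exact this
    have hMN : M ≤ N := fun m hm => ⟨C ⟨m, hm⟩, by simp⟩
    have hmem : (α, β) ∈ N := ⟨X, by simp⟩
    exact ⟨⟨(α, β), hM.le_of_ge hN hMN hmem⟩, rfl, rfl⟩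

end Consistent

section Germ

open Filter

theorem PolyIVT.germ {T ι : Type*} [Field T] [LinearOrder T] [IsStrictOrderedRing T]
    (hT : PolyIVT T) (U : Ultrafilter ι) : PolyIVT (Germ (U : Filter ι) T) := by
  intro P a b hab ha hb
  obtain ⟨Q, rfl⟩ := Polynomial.map_surjective (Germ.coeRingHom (U : Filter ι))
    (fun x => x.inductionOn fun f => ⟨f, rfl⟩) P
  induction a using Germ.inductionOn with | _ a
  induction b using Germ.inductionOn with | _ b
  have key : ∀ f : ι → T, (Q.map (Germ.coeRingHom (U : Filter ι))).eval (f : Germ (U : Filter ι) T) =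
      ((fun x => (Q.map (Pi.evalRingHom _ x)).eval (f x) : ι → T) : Germ (U : Filter ι) T) := by
    intro f
    rw [Polynomial.eval_map, ← Germ.coe_coeRingHom, Polynomial.eval₂_at_apply]
    congr 1
    funext x
    rw [Polynomial.eval_map]
    exact (Polynomial.eval₂_at_apply (Pi.evalRingHom (fun _ => T) x) f).symm
  rw [key] at ha hb
  have h : ∀ x, ∃ c, a x ≤ b x → (Q.map (Pi.evalRingHom _ x)).eval (a x) ≤ 0 →
      0 ≤ (Q.map (Pi.evalRingHom _ x)).eval (b x) →
      c ∈ Set.Icc (a x) (b x) ∧ (Q.map (Pi.evalRingHom _ x)).eval c = 0 := by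
    intro x
    by_cases h : a x ≤ b x ∧ (Q.map (Pi.evalRingHom _ x)).eval (a x) ≤ 0 ∧
      0 ≤ (Q.map (Pi.evalRingHom _ x)).eval (b x)
    · obtain ⟨c, hc⟩ := hT _ _ _ h.1 h.2.1 h.2.2
      exact ⟨c, fun _ _ _ => hc⟩
    · exact ⟨0, fun h1 h2 h3 => absurd ⟨h1, h2, h3⟩ h⟩
  choose c hc using h
  have hab' := Germ.coe_le.1 hab
  have ha' := Germ.coe_le.1 ha
  have hb' := Germ.coe_le.1 hb
  have hall : ∀ᶠ x in (U : Filter ι), c x ∈ Set.Icc (a x) (b x) ∧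
      (Q.map (Pi.evalRingHom _ x)).eval (c x) = 0 := by
    filter_upwards [hab', ha', hb'] with x h1 h2 h3 using hc x h1 h2 h3
  refine ⟨(c : Germ (U : Filter ι) T), ⟨Germ.coe_le.2 (hall.mono fun x h => h.1.1),
    Germ.coe_le.2 (hall.mono fun x h => h.1.2)⟩, ?_⟩
  rw [key]
  exact Germ.coe_eq.2 (hall.mono fun x h => h.2)

/-- Finite systems of real polynomial equations solvable in the extension `c` of `ℝ` are solvable
over `ℝ`. -/
def ReflectsZeros {T : Type*} [Field T] (n : ℕ) (c : ℝ →+* T) : Prop :=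
  ∀ (F : Finset (MvPolynomial (Fin n) ℝ)) (t : Fin n → T), (∀ p ∈ F, p.eval₂ c t = 0) →
    ∃ x : Fin n → ℝ, ∀ p ∈ F, MvPolynomial.eval x p = 0

theorem ReflectsZeros.germ {T ι : Type*} [Field T] {n : ℕ} {c : ℝ →+* T} (hc : ReflectsZeros n c)
    (U : Ultrafilter ι) : ReflectsZeros n
      (((Germ.coeRingHom (U : Filter ι)).comp (Pi.constRingHom ι T)).comp c) := by
  intro F t ht
  have h : ∀ k, ∃ f : ι → T, (f : Germ (U : Filter ι) T) = t k := fun k =>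
    (t k).inductionOn fun f => ⟨f, rfl⟩
  choose f hf using h
  have key : ∀ p : MvPolynomial (Fin n) ℝ,
      p.eval₂ (((Germ.coeRingHom (U : Filter ι)).comp (Pi.constRingHom ι T)).comp c) t =
        ((fun x => p.eval₂ c fun k => f k x : ι → T) : Germ (U : Filter ι) T) := by
    intro p
    have : t = fun k => Germ.coeRingHom (U : Filter ι) (f k) := funext fun k => (hf k).symm
    rw [this, RingHom.comp_assoc, ← MvPolynomial.hom_eval₂, Germ.coe_coeRingHom]
    congr 1
    funext x
    exact MvPolynomial.hom_eval₂ p _ (Pi.evalRingHom (fun _ => T) x) f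
  have hall : ∀ᶠ x in (U : Filter ι), ∀ p ∈ F, p.eval₂ c (fun k => f k x) = 0 := by
    rw [Filter.eventually_all_finset]
    intro p hp
    exact Germ.coe_eq.1 ((key p).symm.trans (ht p hp))
  obtain ⟨x, hx⟩ := hall.exists
  exact hc F _ hx

open Polynomial in
/-- A consistent subring can be extended to have a given first coordinate, after passing to an
ultrapower of the second factor. -/
theorem IsConsistent.exists_extension {S T : Type} [Field S] [LinearOrder S] [IsStrictOrderedRing S]
    [Field T] [LinearOrder T] [IsStrictOrderedRing T] (hS : PolyIVT S) (hT : PolyIVT T)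
    {L : Subring (S × T)} (hL : IsConsistent L) (s : S) :
    ∃ (ι : Type) (U : Ultrafilter ι) (L' : Subring (S × Germ (U : Filter ι) T)), IsConsistent L' ∧
      (∀ p ∈ L, (p.1, ((Germ.coeRingHom (U : Filter ι)).comp (Pi.constRingHom ι T)) p.2) ∈ L') ∧
      ∃ t, (s, t) ∈ L' := by
  classical
  obtain ⟨M, hLM, hM⟩ := hL.exists_le_maximal
  have hpair := IsConsistent.isMaximalPair hM
  choose m hm using hpair.exists_realization hS hT s
  let U : Ultrafilter (Finset M[X]) := Ultrafilter.of atTop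
  have hU : (U : Filter (Finset M[X])) ≤ atTop := Ultrafilter.of_le _
  let e := (Germ.coeRingHom (U : Filter (Finset M[X]))).comp (Pi.constRingHom (Finset M[X]) T)
  let i := (RingHom.fst S T).comp M.subtype
  let j := (RingHom.snd S T).comp M.subtype
  let t : Germ (U : Filter (Finset M[X])) T := Germ.coeRingHom (U : Filter (Finset M[X]))
    (fun F => j (m F))
  refine ⟨Finset M[X], U, (eval₂RingHom (i.prod (e.comp j)) (s, t)).range, ?_, ?_, t, X, by simp⟩
  · rintro _ ⟨g, rfl⟩
    have h1 : (eval₂RingHom (i.prod (e.comp j)) (s, t) g).1 = g.eval₂ i s := by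
      rw [← RingHom.coe_fst, coe_eval₂RingHom, hom_eval₂]
      rfl
    have h2 : (eval₂RingHom (i.prod (e.comp j)) (s, t) g).2 =
        ((fun F => j (g.eval (m F)) : Finset M[X] → T) : Germ (U : Filter (Finset M[X])) T) := by
      rw [← RingHom.coe_snd, coe_eval₂RingHom, hom_eval₂]
      change g.eval₂ ((Germ.coeRingHom (U : Filter (Finset M[X]))).comp
        ((Pi.constRingHom (Finset M[X]) T).comp j)) (Germ.coeRingHom (U : Filter (Finset M[X]))
          (fun F => j (m F))) = _
      rw [← hom_eval₂, Germ.coe_coeRingHom]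
      congr 1
      funext F
      rw [← eval₂_hom]
      exact hom_eval₂ g _ (Pi.evalRingHom (fun _ => T) F) _
    rw [h1, h2, Germ.coe_pos]
    have hev : ∀ᶠ F in (U : Filter (Finset M[X])), (0 < g.eval₂ i s ↔ 0 < j (g.eval (m F))) :=
      hU ((eventually_ge_atTop {g}).mono fun F hF => hm F g (hF (Finset.mem_singleton_self g)))
    constructor
    · intro h
      exact hev.mono fun F hF => hF.1 h
    · intro h
      obtain ⟨F, hF, hF'⟩ := (hev.and h).exists
      exact hF.2 hF'
  · intro p hp
    exact ⟨C ⟨p, hLM hp⟩, by rw [coe_eval₂RingHom, eval₂_C]; rfl⟩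

theorem polyIVT_real : PolyIVT ℝ := by
  intro P a b hab ha hb
  exact intermediate_value_Icc hab P.continuous.continuousOn ⟨ha, hb⟩

theorem exists_isConsistent {S : Type} [Field S] [LinearOrder S] [IsStrictOrderedRing S]
    (hS : PolyIVT S) (φ : ℝ →+* S) (n : ℕ) (l : List S) :
    ∃ (T : Type) (_ : Field T) (_ : LinearOrder T) (_ : IsStrictOrderedRing T), PolyIVT T ∧
      ∃ (c : ℝ →+* T) (L : Subring (S × T)), ReflectsZeros n c ∧ IsConsistent L ∧
        (∀ r, (φ r, c r) ∈ L) ∧ ∀ s ∈ l, ∃ t, (s, t) ∈ L := by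
  induction l with
  | nil =>
    refine ⟨ℝ, inferInstance, inferInstance, inferInstance, polyIVT_real, RingHom.id ℝ,
      (φ.prod (RingHom.id ℝ)).range, fun F t ht => ⟨t, ht⟩, ?_, fun r => ⟨r, rfl⟩, by simp⟩
    have hφ : ∀ r, 0 < r → 0 < φ r := by
      intro r hr
      have h0 : φ r ≠ 0 := (map_ne_zero φ).2 hr.ne'
      rw [← Real.mul_self_sqrt hr.le, map_mul] at h0 ⊢
      exact lt_of_le_of_ne (mul_self_nonneg _) h0.symm
    rintro _ ⟨r, rfl⟩
    refine ⟨fun h => ?_, hφ r⟩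
    change 0 < φ r at h
    change 0 < r
    by_contra! hr
    rcases hr.lt_or_eq with hr | rfl
    · have := hφ (-r) (by linarith)
      rw [map_neg] at this
      linarith
    · simp at h
  | cons s l ih =>
    obtain ⟨T, _, _, _, hT, c, L, hc, hL, hr, hl⟩ := ih
    obtain ⟨ι, U, L', hL', hLL', t, ht⟩ := hL.exists_extension hS hT s
    refine ⟨Germ (U : Filter ι) T, inferInstance, inferInstance, inferInstance, hT.germ U, _, L',
      hc.germ U, hL', fun r => hLL' _ (hr r), ?_⟩
    intro s' hs'
    rcases List.mem_cons.1 hs' with rfl | hs'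
    · exact ⟨t, ht⟩
    · obtain ⟨t', ht'⟩ := hl s' hs'
      exact ⟨_, hLL' _ ht'⟩

/-- Artin–Lang: finite systems of real polynomial equations solvable in an ordered extension
satisfying the intermediate value property are solvable over `ℝ`. -/
theorem PolyIVT.reflectsZeros {S : Type} [Field S] [LinearOrder S] [IsStrictOrderedRing S]
    (hS : PolyIVT S) (φ : ℝ →+* S) (n : ℕ) : ReflectsZeros n φ := by
  intro F s hs
  obtain ⟨T, _, _, _, -, c, L, hc, hL, hr, hl⟩ := exists_isConsistent hS φ n (List.ofFn s)
  have h : ∀ k, ∃ t, (s k, t) ∈ L := fun k => hl _ (by simp)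
  choose t ht using h
  refine hc F t fun p hp => ?_
  have hmem : ∀ q : MvPolynomial (Fin n) ℝ, q.eval₂ (φ.prod c) (fun k => (s k, t k)) ∈ L := by
    intro q
    induction q using MvPolynomial.induction_on with
    | C a => rw [MvPolynomial.eval₂_C]; exact hr a
    | add p q hp hq => rw [MvPolynomial.eval₂_add]; exact add_mem hp hq
    | mul_X p k hp =>
      rw [MvPolynomial.eval₂_mul, MvPolynomial.eval₂_X]
      exact mul_mem hp (ht k)
  have h1 := MvPolynomial.hom_eval₂ p (φ.prod c) (RingHom.fst S T) (fun k => (s k, t k))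
  have h2 := MvPolynomial.hom_eval₂ p (φ.prod c) (RingHom.snd S T) (fun k => (s k, t k))
  exact h2.symm.trans (hL.snd_eq_zero (hmem p) (h1.trans (hs p hp)))

end Germ

section Nullstellensatz

theorem IsSumSq.exists_lift_fractionRing {R : Type*} [CommRing R] (P : Ideal R) [P.IsPrime]
    {σ : FractionRing (R ⧸ P)} (hσ : IsSumSq σ) : ∃ d τ : R, d ∉ P ∧ IsSumSq τ ∧
      algebraMap (R ⧸ P) (FractionRing (R ⧸ P)) (Ideal.Quotient.mk P τ) =
        algebraMap (R ⧸ P) (FractionRing (R ⧸ P)) (Ideal.Quotient.mk P d) ^ 2 * σ := by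
  induction hσ with
  | zero => exact ⟨1, 0, (Ideal.ne_top_iff_one P).1 ‹P.IsPrime›.ne_top, IsSumSq.zero, by simp⟩
  | @sq_add a s _ ih =>
    obtain ⟨d, τ, hd, hτ, h⟩ := ih
    obtain ⟨u, v, hv, rfl⟩ := IsFractionRing.div_surjective (A := R ⧸ P) a
    obtain ⟨u, rfl⟩ := Ideal.Quotient.mk_surjective u
    obtain ⟨v, rfl⟩ := Ideal.Quotient.mk_surjective v
    have hv0 : Ideal.Quotient.mk P v ≠ 0 := nonZeroDivisors.ne_zero hv
    have hv0' : algebraMap (R ⧸ P) (FractionRing (R ⧸ P)) (Ideal.Quotient.mk P v) ≠ 0 := by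
      rwa [Ne, FaithfulSMul.algebraMap_eq_zero_iff]
    refine ⟨d * v, (d * u) * (d * u) + v * v * τ, ?_, ?_, ?_⟩
    · intro hdv
      rcases ‹P.IsPrime›.mem_or_mem hdv with h' | h'
      · exact hd h'
      · exact hv0 (Ideal.Quotient.eq_zero_iff_mem.2 h')
    · exact (IsSumSq.mul_self _).add ((IsSumSq.mul_self v).mul hτ)
    · simp only [map_add, map_mul, h]
      field_simp

theorem Ideal.exists_isSemireal_fractionRing {R : Type*} [CommRing R] (J : Ideal R)
    (hJ : ∀ σ, IsSumSq σ → 1 + σ ∉ J) :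
    ∃ P : Ideal R, ∃ _ : P.IsPrime, J ≤ P ∧ IsSemireal (FractionRing (R ⧸ P)) := by
  let N : Submonoid R :=
    { carrier := {r | ∃ σ, IsSumSq σ ∧ r = 1 + σ}
      one_mem' := ⟨0, IsSumSq.zero, (add_zero 1).symm⟩
      mul_mem' := by
        rintro _ _ ⟨σ, hσ, rfl⟩ ⟨τ, hτ, rfl⟩
        exact ⟨σ + (τ + σ * τ), hσ.add (hτ.add (hσ.mul hτ)), by ring⟩ }
  obtain ⟨P, hJP, hP⟩ : ∃ P : Ideal R, J ≤ P ∧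
      Maximal (fun Q : Ideal R => Disjoint (Q : Set R) N) P := by
    refine zorn_le_nonempty₀ {Q : Ideal R | Disjoint (Q : Set R) N} (fun c hc hc' x hx => ?_) J ?_
    · refine ⟨sSup c, Set.disjoint_left.2 fun y hy => ?_, fun _ => le_sSup⟩
      obtain ⟨p, hp, hyp⟩ := (Submodule.mem_sSup_of_directed ⟨x, hx⟩ hc'.directedOn).1 hy
      exact Set.disjoint_left.1 (hc hp) hyp
    · refine Set.disjoint_left.2 ?_
      rintro _ h ⟨σ, hσ, rfl⟩
      exact hJ σ hσ h
  have hprime : P.IsPrime :=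
    Ideal.isPrime_of_maximally_disjoint _ _ hP.1 fun _ => hP.not_prop_of_gt
  refine ⟨P, hprime, hJP, ⟨fun {s} hs h0 => ?_⟩⟩
  obtain ⟨d, τ, hd, hτ, h⟩ := hs.exists_lift_fractionRing P
  have hmem : d * d + τ ∈ P := by
    rw [← Ideal.Quotient.eq_zero_iff_mem,
      ← FaithfulSMul.algebraMap_eq_zero_iff (R ⧸ P) (FractionRing (R ⧸ P)), map_add, map_add, h,
      map_mul, map_mul]
    linear_combination
      (algebraMap (R ⧸ P) (FractionRing (R ⧸ P)) (Ideal.Quotient.mk P d)) ^ 2 * h0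
  have hnd := hP.not_prop_of_gt (Submodule.lt_sup_iff_notMem.2 hd : P < P ⊔ Ideal.span {d})
  obtain ⟨_, hx, σ, hσ, rfl⟩ := Set.not_disjoint_iff.1 hnd
  obtain ⟨p, hp, _, hq, he⟩ := Submodule.mem_sup.1 hx
  obtain ⟨b, rfl⟩ := Ideal.mem_span_singleton'.1 hq
  have hdisj : Disjoint (P : Set R) N := hP.1
  refine Set.disjoint_left.1 hdisj
    (?_ : (1 + σ) * (1 + σ) + b * b * τ ∈ (P : Set R))
    ⟨σ + (σ + σ * σ) + b * b * τ,
      (hσ.add (hσ.add (hσ.mul hσ))).add ((IsSumSq.mul_self b).mul hτ), by ring⟩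
  have : (1 + σ) * (1 + σ) + b * b * τ = (p + 2 * b * d) * p + b * b * (d * d + τ) := by
    rw [← he]; ring
  rw [SetLike.mem_coe, this]
  exact add_mem (P.mul_mem_left _ hp) (P.mul_mem_left _ hmem)

/-- The weak real Nullstellensatz. -/
theorem MvPolynomial.exists_real_zero {n : ℕ} (J : Ideal (MvPolynomial (Fin n) ℝ))
    (hJ : ∀ σ, IsSumSq σ → 1 + σ ∉ J) : ∃ x : Fin n → ℝ, ∀ p ∈ J, eval x p = 0 := by
  obtain ⟨P, hP, hJP, hK⟩ := J.exists_isSemireal_fractionRing hJ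
  obtain ⟨S, _, _, _, hS, ⟨e⟩⟩ := IsSemireal.exists_polyIVT
    (FractionRing (MvPolynomial (Fin n) ℝ ⧸ P))
  let ψ : MvPolynomial (Fin n) ℝ →+* S := (e.comp (algebraMap _ _)).comp (Ideal.Quotient.mk P)
  have hψ : ∀ p ∈ J, ψ p = 0 := fun p hp => by
    change e (algebraMap _ _ (Ideal.Quotient.mk P p)) = 0
    rw [Ideal.Quotient.eq_zero_iff_mem.2 (hJP hp), map_zero, map_zero]
  have hψe : ∀ p, p.eval₂ (ψ.comp C) (fun k => ψ (X k)) = ψ p := fun p => by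
    rw [← hom_eval₂, eval₂_eta]
  obtain ⟨F, rfl⟩ := (isNoetherianRing_iff_ideal_fg _).1 inferInstance J
  obtain ⟨x, hx⟩ := hS.reflectsZeros (ψ.comp C) n F (fun k => ψ (X k)) fun p hp => by
    rw [hψe, hψ p (Ideal.subset_span hp)]
  refine ⟨x, fun p hp => ?_⟩
  have : Ideal.span (F : Set (MvPolynomial (Fin n) ℝ)) ≤ RingHom.ker (eval x) :=
    Ideal.span_le.2 hx
  exact this hp

end Nullstellensatz

section Functional

open MvPolynomial

theorem evalC_map_ofReal {n : ℕ} (Q : MvPolynomial (Fin n) ℝ) (x : Fin n → ℝ) :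
    evalC (map Complex.ofRealHom Q) x = (eval x Q : ℂ) := by
  rw [evalC, aeval_def, eval₂_map]
  exact (hom_eval₂ Q (RingHom.id ℝ) Complex.ofRealHom x).symm

theorem evalC_starC {n : ℕ} (P : MvPolynomial (Fin n) ℂ) (x : Fin n → ℝ) :
    evalC (starC P) x = starRingEnd ℂ (evalC P x) := by
  rw [evalC, evalC, starC, aeval_def, aeval_def, eval₂_map, hom_eval₂]
  simp [Algebra.algebraMap_self]

theorem starC_map_ofReal {n : ℕ} (Q : MvPolynomial (Fin n) ℝ) :
    starC (map Complex.ofRealHom Q) = map Complex.ofRealHom Q := by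
  rw [starC, map_map]
  exact congrArg (fun f => map f Q) (RingHom.ext Complex.conj_ofReal)

theorem exists_eq_map_add_I_mul_map {n : ℕ} (P : MvPolynomial (Fin n) ℂ) :
    ∃ Q R : MvPolynomial (Fin n) ℝ,
      P = map Complex.ofRealHom Q + C Complex.I * map Complex.ofRealHom R := by
  induction P using MvPolynomial.induction_on with
  | C a =>
    refine ⟨C a.re, C a.im, ?_⟩
    rw [map_C, map_C, ← C_mul, ← C_add, mul_comm]
    exact congrArg C (Complex.re_add_im a).symm
  | add p q hp hq =>
    obtain ⟨Q, R, rfl⟩ := hp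
    obtain ⟨Q', R', rfl⟩ := hq
    exact ⟨Q + Q', R + R', by rw [map_add, map_add]; ring⟩
  | mul_X p k hp =>
    obtain ⟨Q, R, rfl⟩ := hp
    exact ⟨Q * X k, R * X k, by rw [map_mul, map_mul, map_X]; ring⟩

theorem Complex.eq_zero_of_forall_nonneg_add_mul {a u : ℂ} (h : ∀ t : ℝ, 0 ≤ a + t * u) :
    u = 0 := by
  simp only [Complex.nonneg_iff, add_re, re_ofReal_mul, add_im, im_ofReal_mul] at h
  have h0 := (h 0).2
  have h1 := (h 1).2
  refine Complex.ext ?_ (by rw [zero_im]; linarith)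
  by_contra! hu
  rw [zero_re] at hu
  have := (h (-(a.re + 1) / u.re)).1
  rw [div_mul_cancel₀ _ hu] at this
  linarith

theorem IsPosDefC.eq_zero {n : ℕ} {Λ : MvPolynomial (Fin n) ℂ →ₗ[ℂ] ℂ} (hΛ : IsPosDefC Λ)
    (h1 : Λ 1 = 0) : Λ = 0 := by
  refine LinearMap.ext fun P => ?_
  have key : ∀ c : ℂ, Λ (starC P * P) + (starRingEnd ℂ c * Λ P + c * Λ (starC P)) =
      Λ (starC (P + C c) * (P + C c)) := by
    intro c
    have : starC (P + C c) * (P + C c) = starC P * P + starRingEnd ℂ c • P + c • starC P +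
        (starRingEnd ℂ c * c) • (1 : MvPolynomial (Fin n) ℂ) := by
      simp only [starC, map_add, map_C, smul_eq_C_mul, C_mul]
      ring
    rw [this]
    simp only [map_add, map_smul, h1, smul_eq_mul]
    ring
  have hsum : Λ P + Λ (starC P) = 0 := by
    refine Complex.eq_zero_of_forall_nonneg_add_mul (a := Λ (starC P * P)) fun t => ?_
    have := key t
    rw [Complex.conj_ofReal, ← mul_add] at this
    rw [this]
    exact hΛ _
  have hdiff : Complex.I * (Λ (starC P) - Λ P) = 0 := by
    refine Complex.eq_zero_of_forall_nonneg_add_mul (a := Λ (starC P * P)) fun t => ?_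
    have := key (t * Complex.I)
    rw [map_mul (starRingEnd ℂ), Complex.conj_ofReal, Complex.conj_I] at this
    rw [show (t : ℂ) * (Complex.I * (Λ (starC P) - Λ P)) =
      t * -Complex.I * Λ P + t * Complex.I * Λ (starC P) by ring, this]
    exact hΛ _
  have hdiff' := (mul_eq_zero.1 hdiff).resolve_left Complex.I_ne_zero
  rw [LinearMap.zero_apply]
  linear_combination (hsum - hdiff') / 2

theorem IsPosDefC.map_one_eq_zero {n : ℕ} {Λ : MvPolynomial (Fin n) ℂ →ₗ[ℂ] ℂ}
    (hΛ : IsPosDefC Λ) {σ : MvPolynomial (Fin n) ℝ} (hσ : IsSumSq σ)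
    (h : Λ (map Complex.ofRealHom (1 + σ)) = 0) : Λ 1 = 0 := by
  have hpos : 0 ≤ Λ (map Complex.ofRealHom σ) := by
    clear h
    induction hσ with
    | zero => simp
    | sq_add a _ ih =>
      rw [map_add, map_add, map_mul]
      have := hΛ (map Complex.ofRealHom a)
      rw [starC_map_ofReal] at this
      exact add_nonneg this ih
  have h1 : 0 ≤ Λ 1 := by simpa [starC] using hΛ 1
  rw [map_add, map_add, map_one] at h
  exact ((add_eq_zero_iff_of_nonneg h1 hpos).1 h).1

theorem exists_mem_zeroSetC {n : ℕ} (I : Ideal (MvPolynomial (Fin n) ℂ))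
    (hstar : ∀ P ∈ I, starC P ∈ I)
    (hI : ∀ σ : MvPolynomial (Fin n) ℝ, IsSumSq σ → map Complex.ofRealHom (1 + σ) ∉ I) :
    (zeroSetC I).Nonempty := by
  obtain ⟨x, hx⟩ := exists_real_zero (I.comap (map Complex.ofRealHom)) hI
  refine ⟨x, fun P hP => ?_⟩
  obtain ⟨Q, R, rfl⟩ := exists_eq_map_add_I_mul_map P
  have hs := hstar _ hP
  have hstarP : starC (map Complex.ofRealHom Q + C Complex.I * map Complex.ofRealHom R) =
      map Complex.ofRealHom Q - C Complex.I * map Complex.ofRealHom R := by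
    have h1 := starC_map_ofReal Q
    have h2 := starC_map_ofReal R
    unfold starC at h1 h2 ⊢
    rw [map_add, map_mul, h1, h2, map_C, Complex.conj_I, C_neg]
    ring
  rw [hstarP] at hs
  have hII : (C Complex.I * C Complex.I : MvPolynomial (Fin n) ℂ) = -1 := by
    rw [← C_mul, Complex.I_mul_I, C_neg, C_1]
  have hhalf : (C 2⁻¹ * 2 : MvPolynomial (Fin n) ℂ) = 1 := by
    rw [← map_ofNat C 2, ← C_mul, inv_mul_cancel₀ two_ne_zero, C_1]
  have hQ : map Complex.ofRealHom Q ∈ I := by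
    convert I.mul_mem_left (C 2⁻¹) (add_mem hP hs) using 1
    linear_combination (-map Complex.ofRealHom Q) * hhalf
  have hR : map Complex.ofRealHom R ∈ I := by
    convert I.mul_mem_left (-C Complex.I) (sub_mem hP hQ) using 1
    linear_combination map Complex.ofRealHom R * hII
  have h1 := evalC_map_ofReal Q x
  have h2 := evalC_map_ofReal R x
  rw [hx Q hQ] at h1
  rw [hx R hR] at h2
  unfold evalC at h1 h2 ⊢
  rw [map_add, map_mul, h1, h2]
  simp

theorem exists_posDef_of_mem_zeroSetC {n : ℕ} {I : Ideal (MvPolynomial (Fin n) ℂ)}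
    {x : Fin n → ℝ} (hx : x ∈ zeroSetC I) :
    ∃ Λ : MvPolynomial (Fin n) ℂ →ₗ[ℂ] ℂ, IsPosDefC Λ ∧ VanishesOnC Λ I ∧ Λ ≠ 0 := by
  refine ⟨(aeval (R := ℂ) fun i => (x i : ℂ)).toLinearMap, fun P => ?_, hx, fun h => ?_⟩
  · have h := evalC_starC P x
    unfold evalC at h
    rw [AlgHom.toLinearMap_apply, map_mul, h, mul_comm, Complex.mul_conj]
    exact_mod_cast Complex.normSq_nonneg _
  · have := LinearMap.congr_fun h 1
    simp at this

end Functional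

theorem stmt_19 (n : ℕ) (hn : 0 < n) (I : Ideal (MvPolynomial (Fin n) ℂ))
    (hproper : I ≠ ⊤) (hstar : ∀ P ∈ I, starC P ∈ I) :
    zeroSetC I = ∅ ↔
      (∀ Λ : MvPolynomial (Fin n) ℂ →ₗ[ℂ] ℂ, IsPosDefC Λ → VanishesOnC Λ I → Λ = 0) := by
  constructor
  · intro hZ Λ hΛ hΛI
    by_contra hne
    have hnon := exists_mem_zeroSetC I hstar fun σ hσ h =>
      hne (hΛ.eq_zero (hΛ.map_one_eq_zero hσ (hΛI _ h)))
    exact hnon.ne_empty hZ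
  · intro h
    by_contra hne
    obtain ⟨x, hx⟩ := Set.nonempty_iff_ne_empty.2 hne
    obtain ⟨Λ, hΛ, hΛI, h0⟩ := exists_posDef_of_mem_zeroSetC hx
    exact h0 (h Λ hΛ hΛI)
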